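/- arXiv:2109.00908 — 2 statements merged into one kernel-verified Lean document; each statement's English description precedes it below -/
import Mathlib

section
/- Let R be a commutative ring of characteristic 2, n a positive integer, and λ, μ ∈ R with λ² = 1 and μ² = 1. Let A = circ_λ(a), B = circ_λ(b) and C = circ_μ(c) for a, b, c ∈ Rⁿ, and let X be the 2n×2n block matrix X = [[AC, B], [BᵀC, Aᵀ]]. Then XXᵀ = I_{2n} if and only if AAᵀ + BBᵀ = I_n and CCᵀ = I_n. -/
open Matrix

/-- The `λ`-circulant matrix generated by the vector `a`. -/
def lamCirc {R : Type*} [CommRing R] {n : ℕ} (l : R) (a : Fin n → R) :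
    Matrix (Fin n) (Fin n) R :=
  Matrix.of fun i j => if (i : ℕ) ≤ (j : ℕ) then a (j - i) else l * a (j - i)

/-- The number of wrap-arounds in passing from `i` to `j`. -/
def wrapCount {n : ℕ} (i j : Fin n) : ℕ := if (i : ℕ) ≤ (j : ℕ) then 0 else 1

theorem val_sub_add_val {n : ℕ} (i j : Fin n) :
    ((j - i : Fin n) : ℕ) + i = j + n * wrapCount i j := by
  unfold wrapCount
  split_ifs with h
  · rw [Fin.sub_val_of_le h]
    lia
  · rw [Fin.coe_sub_iff_lt.mpr (not_le.mp h)]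
    lia

theorem lamCirc_apply {R : Type*} [CommRing R] {n : ℕ} (l : R) (a : Fin n → R) (i j : Fin n) :
    lamCirc l a i j = l ^ wrapCount i j * a (j - i) := by
  unfold lamCirc wrapCount
  simp only [Matrix.of_apply]
  split_ifs <;> simp

theorem lamCirc_commute {R : Type*} [CommRing R] {n : ℕ} [NeZero n] (l : R) (a b : Fin n → R) :
    Commute (lamCirc l a) (lamCirc l b) := by
  ext i j
  simp only [Matrix.mul_apply, lamCirc_apply]
  refine Fintype.sum_equiv (Equiv.subLeft (i + j)) _ _ fun k => ?_
  have h₁ : i + j - k - i = j - k := by abel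
  have h₂ : j - (i + j - k) = k - i := by abel
  have hw : wrapCount i k + wrapCount k j =
      wrapCount i (i + j - k) + wrapCount (i + j - k) j := by
    have e₁ := val_sub_add_val i k
    have e₂ := val_sub_add_val k j
    have e₃ := val_sub_add_val i (i + j - k)
    have e₄ := val_sub_add_val (i + j - k) j
    rw [h₁] at e₃
    rw [h₂] at e₄
    refine Nat.eq_of_mul_eq_mul_left (NeZero.pos n) ?_
    rw [mul_add, mul_add]
    lia
  have hp := congrArg (l ^ ·) hw
  simp only [pow_add] at hp
  simp only [Equiv.subLeft_apply, h₁, h₂]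
  linear_combination a (k - i) * b (j - k) * hp

theorem lamCirc_transpose {R : Type*} [CommRing R] {n : ℕ} [NeZero n] {l : R} (hl : l ^ 2 = 1)
    (a : Fin n → R) :
    (lamCirc l a)ᵀ = lamCirc l fun d => if d = 0 then a 0 else l * a (-d) := by
  ext i j
  simp only [Matrix.transpose_apply, lamCirc, Matrix.of_apply, sub_eq_zero, neg_sub]
  rcases lt_trichotomy i j with h | rfl | h
  · have h' : (i : ℕ) < j := h
    simp [h'.le, h'.not_ge, h.ne']
  · simp
  · have h' : (j : ℕ) < i := h
    simp only [h'.le, h'.not_ge, h.ne, if_true, if_false]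
    linear_combination -a (i - j) * hl

/-- The equivalence holds for an arbitrary `C` as soon as `A`, `B` and their transposes commute. -/
theorem fromBlocks_mul_transpose_eq_one_iff_of_commute {R ι : Type*} [CommRing R] [Fintype ι]
    [DecidableEq ι] (h2 : (2 : R) = 0) {A B C : Matrix ι ι R} (hAB : Commute A B)
    (hAA : Commute A Aᵀ) (hBB : Commute B Bᵀ) :
    fromBlocks (A * C) B (Bᵀ * C) Aᵀ * (fromBlocks (A * C) B (Bᵀ * C) Aᵀ)ᵀ = 1 ↔
      A * Aᵀ + B * Bᵀ = 1 ∧ C * Cᵀ = 1 := by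
  constructor
  · intro h
    rw [mul_eq_one_comm, fromBlocks_transpose, fromBlocks_multiply, ← fromBlocks_one,
      fromBlocks_inj] at h
    obtain ⟨h₁, -, -, h₄⟩ := h
    have hD : A * Aᵀ + B * Bᵀ = 1 := by
      rw [hBB.eq, add_comm]
      simpa using h₄
    refine ⟨hD, mul_eq_one_comm.mp ?_⟩
    calc Cᵀ * C = Cᵀ * (A * Aᵀ + B * Bᵀ) * C := by rw [hD, mul_one]
      _ = 1 := by
        rw [hAA.eq, ← h₁]
        simp only [transpose_mul, transpose_transpose]
        noncomm_ring
  · rintro ⟨hD, hC⟩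
    have hC' (M N : Matrix ι ι R) : M * C * (Cᵀ * N) = M * N := by
      rw [mul_assoc, ← mul_assoc C, hC, one_mul]
    have hdouble (M : Matrix ι ι R) : M + M = 0 := by
      rw [← two_smul R, h2, zero_smul]
    have hBA : Bᵀ * Aᵀ = Aᵀ * Bᵀ := by rw [← transpose_mul, hAB.eq, transpose_mul]
    rw [fromBlocks_transpose, fromBlocks_multiply, ← fromBlocks_one, fromBlocks_inj]
    simp only [transpose_mul, transpose_transpose, hC']
    refine ⟨hD, ?_, ?_, ?_⟩
    · rw [hAB.eq, hdouble]
    · rw [hBA, hdouble]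
    · rw [← hAA.eq, ← hBB.eq, add_comm, hD]

/-- Let `R` be a commutative ring of characteristic 2, `λ, μ ∈ R` with `λ² = μ² = 1`,
`A, B` `λ`-circulant and `C` `μ`-circulant, and let `X` be the block matrix
`[[AC, B], [BᵀC, Aᵀ]]`.  Then `X Xᵀ = I_{2n}` iff `A Aᵀ + B Bᵀ = I_n` and `C Cᵀ = I_n`. -/
theorem fromBlocks_mul_transpose_eq_one_iff {R : Type*} [CommRing R] (h2 : (2 : R) = 0)
    {n : ℕ} (hn : 0 < n) (l m : R) (hl : l ^ 2 = 1) (hm : m ^ 2 = 1)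
    (a b c : Fin n → R) :
    let A := lamCirc l a
    let B := lamCirc l b
    let C := lamCirc m c
    let X := Matrix.fromBlocks (A * C) B (Bᵀ * C) Aᵀ
    X * Xᵀ = 1 ↔ (A * Aᵀ + B * Bᵀ = 1 ∧ C * Cᵀ = 1) := by
  have : NeZero n := ⟨hn.ne'⟩
  intro A B C X
  refine fromBlocks_mul_transpose_eq_one_iff_of_commute h2 (lamCirc_commute l a b) ?_ ?_ <;>
    · rw [lamCirc_transpose hl]
      exact lamCirc_commute l _ _
end

section
/- There exists a binary self-dual code 𝒞 ⊆ 𝔽₂^{68} of dimension 34 and minimum Hamming distance 12 whose weight enumerator satisfies A₁₂ = 442 + 4α and A₁₄ = 10864 − 8α with α = 110 (i.e., A₁₂ = 882 and A₁₄ = 9984). -/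
/-- The Hamming weight of a binary vector. -/
def wt {m : ℕ} (x : Fin m → ZMod 2) : ℕ :=
  (Finset.univ.filter fun i => x i ≠ 0).card

/-! ### Sums of `k` vectors from a list -/

/-- The sums over the `k`-element sublists of a list of vectors. -/
def subsums {V : Type*} [AddMonoid V] : List V → ℕ → List V
  | _, 0 => [0]
  | [], _ + 1 => []
  | r :: rs, k + 1 => subsums rs (k + 1) ++ (subsums rs k).map (r + ·)

theorem wt_eq_sum {m : ℕ} (x : Fin m → ZMod 2) : wt x = ∑ i, if x i ≠ 0 then 1 else 0 := by
  simp only [wt, Finset.card_filter]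

theorem wt_cons {m : ℕ} (a : ZMod 2) (x : Fin m → ZMod 2) :
    wt (Fin.cons a x : Fin (m + 1) → ZMod 2) = (if a ≠ 0 then 1 else 0) + wt x := by
  simp [wt_eq_sum, Fin.sum_univ_succ]

theorem wt_eq_zero {m : ℕ} {x : Fin m → ZMod 2} : wt x = 0 ↔ x = 0 := by
  simp [wt, Finset.filter_eq_empty_iff, funext_iff]

theorem wt_append {m n : ℕ} (x : Fin m → ZMod 2) (y : Fin n → ZMod 2) :
    wt (Fin.append x y) = wt x + wt y := by
  simp [wt_eq_sum, Fin.sum_univ_add]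

theorem wt_le {m : ℕ} (x : Fin m → ZMod 2) : wt x ≤ m := by
  simpa [wt] using Finset.card_filter_le (Finset.univ : Finset (Fin m)) fun i => x i ≠ 0

theorem card_wt_eq_countP_subsums {V : Type*} [AddCommGroup V] [Module (ZMod 2) V] {n : ℕ}
    (f : Fin n → V) (k : ℕ) (P : V → Bool) :
    (Finset.univ.filter fun u : Fin n → ZMod 2 => wt u = k ∧ P (∑ i, u i • f i)).card
      = (subsums (List.ofFn f) k).countP P := by
  induction n generalizing k P with
  | zero =>
    cases k with
    | zero => cases h : P 0 <;> simp [subsums, wt, h]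
    | succ k => simp [subsums, wt]
  | succ n ih =>
    cases k with
    | zero =>
      have h0 : ∀ u : Fin (n + 1) → ZMod 2, (wt u = 0 ∧ P (∑ i, u i • f i)) ↔ u = 0 ∧ P 0 := by
        intro u
        rw [wt_eq_zero]
        refine and_congr_right ?_
        rintro rfl
        simp
      simp only [h0, subsums]
      cases h : P 0 <;> simp [h, Finset.filter_eq']
    | succ k =>
      rw [List.ofFn_succ, subsums, List.countP_append, List.countP_map, ← ih, ← ih,
        Finset.card_filter, Finset.card_filter, Finset.card_filter,
        ← (Fin.consEquiv fun _ => ZMod 2).sum_comp, Fintype.sum_prod_type]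
      have h2 : ∀ g : ZMod 2 → ℕ, ∑ a, g a = g 0 + g 1 := fun g => Fin.sum_univ_two g
      rw [h2]
      simp only [Fin.consEquiv, Equiv.coe_fn_mk, wt_cons, Fin.sum_univ_succ, Fin.cons_zero,
        Fin.cons_succ, ne_eq, not_true_eq_false, if_false, one_ne_zero, not_false_eq_true, if_true, zero_smul,
        one_smul, zero_add, add_comm 1, Nat.add_right_cancel_iff, Function.comp_apply]

/-! ### Bit-sliced evaluation -/

/-- The number whose `i`-th bit is the value of `f` at the `i`-th list entry. -/
def pack {V : Type*} (L : List V) (f : V → Bool) : ℕ :=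
  L.foldr (fun v n => Nat.bit (f v) n) 0

section pack

variable {V : Type*} (f g : V → Bool)

theorem pack_cons (v : V) (L : List V) : pack (v :: L) f = Nat.bit (f v) (pack L f) := rfl

theorem pack_congr {f g : V → Bool} (h : ∀ v, f v = g v) (L : List V) : pack L f = pack L g := by
  rw [funext h]

theorem pack_append (L M : List V) : pack (L ++ M) f = pack L f + pack M f * 2 ^ L.length := by
  induction L with
  | nil => simp [pack]
  | cons v L ih =>
    rw [List.cons_append, pack_cons, pack_cons, ih, List.length_cons, pow_succ]
    simp only [Nat.bit_val]
    ring

theorem pack_map {W : Type*} (L : List W) (t : W → V) : pack (L.map t) f = pack L (f ∘ t) := by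
  simp [pack, List.foldr_map]

theorem pack_xor (L : List V) : pack L f ^^^ pack L g = pack L fun v => f v ^^ g v := by
  induction L with
  | nil => simp [pack]
  | cons v L ih => simp only [pack_cons, Nat.xor_bit, ih, Bool.xor]

theorem pack_land (L : List V) : pack L f &&& pack L g = pack L fun v => f v && g v := by
  induction L with
  | nil => simp [pack]
  | cons v L ih => simp only [pack_cons, Nat.land_bit, ih]

theorem pack_false (L : List V) : pack L (fun _ => false) = 0 := by
  induction L with
  | nil => simp [pack]
  | cons v L ih => simp [pack_cons, ih]

theorem pack_lt (L : List V) : pack L f < 2 ^ L.length := by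
  induction L with
  | nil => simp [pack]
  | cons v L ih =>
    rw [pack_cons, Nat.bit_val, List.length_cons, pow_succ]
    have := Bool.toNat_lt (f v)
    omega

theorem pack_true (L : List V) : pack L (fun _ => true) = 2 ^ L.length - 1 := by
  induction L with
  | nil => simp [pack]
  | cons v L ih =>
    rw [pack_cons, Nat.bit_val, List.length_cons, pow_succ, ih]
    have := Nat.one_le_two_pow (n := L.length)
    simp only [Bool.toNat_true]
    omega

theorem countP_eq_zero_of_pack_eq_zero (L : List V) (h : pack L f = 0) : L.countP f = 0 := by
  induction L with
  | nil => simp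
  | cons v L ih =>
    rw [pack_cons, Nat.bit_val] at h
    cases hv : f v <;> simp_all

end pack

/-- The number with binary digits `1`, repeated `n` times. -/
def ones (n : ℕ) : ℕ := Nat.sub (Nat.shiftLeft 1 n) 1

theorem ones_eq (n : ℕ) : ones n = 2 ^ n - 1 := by
  show 1 <<< n - 1 = _
  rw [Nat.one_shiftLeft]

/-- The number of sublists of length `k`. -/
def numSub : List Bool → ℕ → ℕ
  | _, 0 => 1
  | [], _ + 1 => 0
  | _ :: bs, k + 1 => Nat.add (numSub bs (k + 1)) (numSub bs k)

theorem numSub_map {V : Type*} [AddMonoid V] (L : List V) (t : V → Bool) (k : ℕ) :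
    numSub (L.map t) k = (subsums L k).length := by
  induction L generalizing k with
  | nil => cases k <;> simp [subsums, numSub]
  | cons v L ih => cases k <;> simp [subsums, numSub, ih]

/-- The packed parities of all sublists of length `k`. -/
def plane : List Bool → ℕ → ℕ
  | _, 0 => 0
  | [], _ + 1 => 0
  | b :: bs, k + 1 =>
    Nat.add (plane bs (k + 1))
      (Nat.shiftLeft (cond b (Nat.xor (plane bs k) (ones (numSub bs k))) (plane bs k))
        (numSub bs (k + 1)))

theorem zmod_two_add_ne_zero (a b : ZMod 2) :
    decide (a + b ≠ 0) = (decide (a ≠ 0) ^^ decide (b ≠ 0)) := by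
  revert a b
  decide

theorem plane_map {m : ℕ} (L : List (Fin m → ZMod 2)) (j : Fin m) (k : ℕ) :
    plane (L.map fun v => decide (v j ≠ 0)) k = pack (subsums L k) fun v => decide (v j ≠ 0) := by
  induction L generalizing k with
  | nil => cases k <;> simp [subsums, plane, pack]
  | cons r L ih =>
    cases k with
    | zero => simp [subsums, plane, pack]
    | succ k =>
      have hx : ∀ a b, Nat.xor a b = a ^^^ b := fun _ _ => rfl
      have hs : ∀ a b, Nat.shiftLeft a b = a <<< b := fun _ _ => rfl
      rw [List.map_cons, plane, subsums, ih, ih, numSub_map, numSub_map, pack_append, pack_map,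
        ones_eq, ← pack_true, hx, pack_xor, hs, Nat.shiftLeft_eq, Nat.add_eq]
      congr 2
      by_cases hr : r j = 0
      · simp only [hr, ne_eq, not_true_eq_false, decide_false, cond_false]
        exact pack_congr (fun v => by simp [hr]) _
      · simp only [ne_eq, hr, not_false_eq_true, decide_true, cond_true]
        refine pack_congr (fun v => ?_) _
        have := zmod_two_add_ne_zero (r j) (v j)
        simp only [ne_eq, hr, not_false_eq_true, decide_true] at this
        simp only [Function.comp_apply, Pi.add_apply, this]
        exact Bool.xor_comm _ _

/-- Add a packed bit to packed counters, given by their bits. -/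
def addBit : ℕ → List ℕ → List ℕ
  | _, [] => []
  | p, c :: cs => Nat.xor c p :: addBit (Nat.land c p) cs

/-- The lowest `d` binary digits of the values of a function, packed. -/
def digits {V : Type*} (L : List V) : (V → ℕ) → ℕ → List ℕ
  | _, 0 => []
  | w, d + 1 => pack L (fun v => decide (w v % 2 = 1)) :: digits L (fun v => w v / 2) d

theorem addBit_digits {V : Type*} (L : List V) (f : V → Bool) (w : V → ℕ) (d : ℕ) :
    addBit (pack L f) (digits L w d) = digits L (fun v => w v + (f v).toNat) d := by
  induction d generalizing f w with
  | zero => rfl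
  | succ d ih =>
    have hx : ∀ a b, Nat.xor a b = a ^^^ b := fun _ _ => rfl
    have ha : ∀ a b, Nat.land a b = a &&& b := fun _ _ => rfl
    rw [digits, addBit, digits, hx, ha, pack_xor, pack_land, ih]
    congr 1
    · refine pack_congr (fun v => ?_) _
      rcases Nat.mod_two_eq_zero_or_one (w v) with h | h <;> cases f v <;> simp [h, Nat.add_mod]
    · congr 1
      funext v
      rcases Nat.mod_two_eq_zero_or_one (w v) with h | h <;> cases f v <;> simp [h] <;> omega

theorem digits_zero {V : Type*} (L : List V) (d : ℕ) :
    digits L (fun _ => 0) d = List.replicate d 0 := by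
  induction d with
  | zero => rfl
  | succ d ih => simp [digits, ih, pack_false, List.replicate_succ]

/-- The lanes in which packed counters have value `l`. -/
def lanesEq (o : ℕ) : ℕ → List ℕ → ℕ
  | _, [] => o
  | l, c :: cs => Nat.land (cond (Nat.beq (l % 2) 1) c (Nat.xor c o)) (lanesEq o (l / 2) cs)

theorem lanesEq_digits {V : Type*} (L : List V) (w : V → ℕ) (d l : ℕ) :
    lanesEq (pack L fun _ => true) l (digits L w d)
      = pack L fun v => decide (w v % 2 ^ d = l % 2 ^ d) := by
  induction d generalizing w l with
  | zero => simp [digits, lanesEq, Nat.mod_one]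
  | succ d ih =>
    have hx : ∀ a b, Nat.xor a b = a ^^^ b := fun _ _ => rfl
    have ha : ∀ a b, Nat.land a b = a &&& b := fun _ _ => rfl
    have key : ∀ x y : ℕ, x % 2 ^ (d + 1) = y % 2 ^ (d + 1) ↔
        x % 2 = y % 2 ∧ x / 2 % 2 ^ d = y / 2 % 2 ^ d := by
      intro x y
      rw [pow_succ', Nat.mod_mul, Nat.mod_mul]
      omega
    rw [digits, lanesEq, ih, ha, hx, pack_xor]
    rcases Nat.mod_two_eq_zero_or_one l with h | h
    · rw [h, show Nat.beq 0 1 = false from rfl, cond_false, pack_land]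
      refine pack_congr (fun v => ?_) _
      simp only [key, h]
      rcases Nat.mod_two_eq_zero_or_one (w v) with h' | h' <;> simp [h']
    · rw [h, show Nat.beq 1 1 = true from rfl, cond_true, pack_land]
      refine pack_congr (fun v => ?_) _
      simp only [key, h]
      rcases Nat.mod_two_eq_zero_or_one (w v) with h' | h' <;> simp [h']

/-- The number of digits `1` of a number with at most `2 ^ d` digits. -/
def popcount : ℕ → ℕ → ℕ
  | 0, m => m
  | d + 1, m => cond (Nat.beq m 0) 0
      (Nat.add (popcount d (Nat.land m (ones (Nat.pow 2 d))))
        (popcount d (Nat.shiftRight m (Nat.pow 2 d))))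

theorem popcount_pack {V : Type*} (f : V → Bool) (d : ℕ) (L : List V) (hL : L.length ≤ 2 ^ d) :
    popcount d (pack L f) = L.countP f := by
  induction d generalizing L with
  | zero =>
    match L, hL with
    | [], _ => simp [popcount, pack]
    | [v], _ => cases h : f v <;> simp [popcount, pack, h]
    | _ :: _ :: _, h => simp at h
  | succ d ih =>
    rw [popcount]
    cases h0 : Nat.beq (pack L f) 0
    · rw [cond_false]
      have ha : ∀ a b, Nat.land a b = a &&& b := fun _ _ => rfl
      have hs : ∀ a b, Nat.shiftRight a b = a >>> b := fun _ _ => rfl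
      have hp : Nat.pow 2 d = 2 ^ d := rfl
      rw [ha, hs, hp, ones_eq, Nat.and_two_pow_sub_one_eq_mod, Nat.shiftRight_eq_div_pow]
      obtain ⟨M, N, rfl, hM, hN, hMN⟩ : ∃ M N, L = M ++ N ∧ M.length ≤ 2 ^ d ∧
          N.length ≤ 2 ^ d ∧ (M.length = 2 ^ d ∨ N = []) := by
        refine ⟨L.take (2 ^ d), L.drop (2 ^ d), (List.take_append_drop _ _).symm, ?_, ?_, ?_⟩
        · simp
        · rw [List.length_drop]
          rw [pow_succ] at hL
          omega
        · rw [List.length_take, List.drop_eq_nil_iff]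
          omega
      have hM' : pack M f < 2 ^ 2 ^ d :=
        (pack_lt f M).trans_le (Nat.pow_le_pow_right (by norm_num) hM)
      rw [pack_append, List.countP_append, ← ih M hM, ← ih N hN, Nat.add_eq]
      rcases hMN with h | rfl
      · rw [h, Nat.add_mul_mod_self_right, Nat.mod_eq_of_lt hM',
          Nat.add_mul_div_right _ _ (by positivity), Nat.div_eq_of_lt hM', zero_add]
      · rw [show pack ([] : List V) f = 0 from rfl, zero_mul, add_zero, Nat.mod_eq_of_lt hM',
          Nat.div_eq_of_lt hM']
    · rw [cond_true, countP_eq_zero_of_pack_eq_zero f L (Nat.eq_of_beq_eq_true h0)]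

/-- A matrix column as a list of bits. -/
def column {n m : ℕ} (M : Matrix (Fin n) (Fin m) (ZMod 2)) (j : Fin m) : List Bool :=
  List.ofFn fun i => decide (M i j ≠ 0)

/-- The packed weights, modulo `2 ^ d`, of all sums of `k` rows of a matrix. -/
def rowSumWts {n m : ℕ} (M : Matrix (Fin n) (Fin m) (ZMod 2)) (d k : ℕ) : List ℕ :=
  (List.finRange m).foldl (fun cs j => addBit (plane (column M j) k) cs) (List.replicate d 0)

theorem rowSumWts_eq {n m : ℕ} (M : Matrix (Fin n) (Fin m) (ZMod 2)) (d k : ℕ) :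
    rowSumWts M d k = digits (subsums (List.ofFn M.row) k) wt d := by
  have hcol : ∀ j, column M j = (List.ofFn M.row).map fun v => decide (v j ≠ 0) := by
    intro j
    rw [List.map_ofFn]
    rfl
  have key : ∀ (J : List (Fin m)) (w : (Fin m → ZMod 2) → ℕ),
      J.foldl (fun cs j => addBit (plane (column M j) k) cs)
          (digits (subsums (List.ofFn M.row) k) w d)
        = digits (subsums (List.ofFn M.row) k)
            (fun v => w v + (J.map fun j => if v j ≠ 0 then 1 else 0).sum) d := by
    intro J
    induction J with
    | nil => simp
    | cons j J ih =>
      intro w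
      rw [List.foldl_cons, hcol, plane_map, addBit_digits, ih]
      congr 1
      funext v
      by_cases h : v j = 0 <;> simp [h, add_assoc]
  rw [rowSumWts, ← digits_zero, key]
  congr 1
  funext v
  rw [zero_add, wt_eq_sum, ← List.ofFn_eq_map, List.sum_ofFn]

/-- The number of sums of `k` rows of a matrix that have weight `l`. -/
def countRowSums {n m : ℕ} (M : Matrix (Fin n) (Fin m) (ZMod 2)) (k l : ℕ) : ℕ :=
  popcount 23 (lanesEq (ones (numSub (List.replicate n true) k)) l (rowSumWts M 6 k))

theorem numSub_replicate (n k : ℕ) {V : Type*} [AddMonoid V] (f : Fin n → V) :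
    numSub (List.replicate n true) k = (subsums (List.ofFn f) k).length := by
  rw [← numSub_map _ fun _ => true]
  simp

theorem countRowSums_eq {n m : ℕ} (M : Matrix (Fin n) (Fin m) (ZMod 2)) {k l : ℕ}
    (hn : numSub (List.replicate n true) k ≤ 2 ^ 23) (hm : m < 2 ^ 6) (hl : l < 2 ^ 6) :
    countRowSums M k l
      = (Finset.univ.filter fun u : Fin n → ZMod 2 => wt u = k ∧ wt (M.vecMul u) = l).card := by
  rw [numSub_replicate n k M.row] at hn
  rw [countRowSums, numSub_replicate n k M.row, rowSumWts_eq, ones_eq, ← pack_true,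
    lanesEq_digits, popcount_pack _ _ _ hn, ← card_wt_eq_countP_subsums]
  congr 1
  refine Finset.filter_congr fun u _ => and_congr_right fun _ => ?_
  rw [decide_eq_true_iff, Nat.mod_eq_of_lt ((wt_le _).trans_lt hm), Nat.mod_eq_of_lt hl,
    Matrix.vecMul_eq_sum]
  rfl

/-! ### Codes with generator matrix `(1 | M)` -/

section doubleCode

variable {n : ℕ} (M : Matrix (Fin n) (Fin n) (ZMod 2))

/-- The encoder with generator matrix `(1 | M)`. -/
def encoder : (Fin n → ZMod 2) →ₗ[ZMod 2] (Fin (n + n) → ZMod 2) where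
  toFun u := Fin.append u (M.vecMul u)
  map_add' u v := by
    ext i
    refine Fin.addCases (fun i => ?_) (fun i => ?_) i <;>
      simp [Matrix.add_vecMul, -Fin.natAdd_eq_addNat]
  map_smul' a u := by
    ext i
    refine Fin.addCases (fun i => ?_) (fun i => ?_) i <;>
      simp [Matrix.smul_vecMul, -Fin.natAdd_eq_addNat]

/-- The number of vectors `u` of weight `k` such that `u ᵥ* M` has weight `l`. -/
def splitCount (k l : ℕ) : ℕ :=
  (Finset.univ.filter fun u : Fin n → ZMod 2 => wt u = k ∧ wt (M.vecMul u) = l).card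

theorem encoder_apply (u : Fin n → ZMod 2) : encoder M u = Fin.append u (M.vecMul u) := rfl

theorem encoder_injective : Function.Injective (encoder M) := by
  intro u v h
  ext i
  simpa [encoder_apply] using congrFun h (Fin.castAdd n i)

theorem wt_encoder (u : Fin n → ZMod 2) : wt (encoder M u) = wt u + wt (M.vecMul u) :=
  wt_append _ _

theorem finrank_range_encoder : Module.finrank (ZMod 2) (encoder M).range = n := by
  rw [LinearMap.finrank_range_of_inj (encoder_injective M), Module.finrank_fin_fun]

theorem ncard_wt_range_encoder (w : ℕ) :
    {x | x ∈ (encoder M).range ∧ wt x = w}.ncard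
      = ∑ k ∈ Finset.range (w + 1), splitCount M k (w - k) := by
  have h : {x | x ∈ (encoder M).range ∧ wt x = w} = encoder M ''
      (Finset.univ.filter fun u : Fin n → ZMod 2 => wt u + wt (M.vecMul u) = w) := by
    ext x
    simp only [Set.mem_ofPred_eq, LinearMap.mem_range, Set.mem_image, Finset.coe_filter,
      Finset.mem_univ, true_and]
    constructor
    · rintro ⟨⟨u, rfl⟩, hu⟩
      exact ⟨u, by rwa [wt_encoder] at hu, rfl⟩
    · rintro ⟨u, hu, rfl⟩
      exact ⟨⟨u, rfl⟩, by rwa [wt_encoder]⟩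
  rw [h, Set.ncard_image_of_injective _ (encoder_injective M), Set.ncard_coe_finset,
    Finset.card_eq_sum_card_fiberwise (f := wt) (t := Finset.range (w + 1))]
  · refine Finset.sum_congr rfl fun k hk => ?_
    rw [Finset.mem_range] at hk
    rw [Finset.filter_filter, splitCount]
    congr 1
    refine Finset.filter_congr fun u _ => ?_
    omega
  · intro u hu
    simp only [Finset.coe_filter, Finset.mem_univ, true_and, Set.mem_ofPred_eq] at hu
    simp only [Finset.coe_range, Set.mem_Iio]
    omega

variable {M}

theorem splitCount_transpose (hM : M * M.transpose = 1) (k l : ℕ) :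
    splitCount M k l = splitCount M.transpose l k := by
  have hM' : M.transpose * M = 1 := mul_eq_one_comm.mp hM
  refine Finset.card_bij' (fun u _ => M.vecMul u) (fun u _ => M.transpose.vecMul u) ?_ ?_ ?_ ?_
  · intro u hu
    simpa [Matrix.vecMul_vecMul, hM, and_comm] using hu
  · intro u hu
    simpa [Matrix.vecMul_vecMul, hM', and_comm] using hu
  · intro u _
    simp [Matrix.vecMul_vecMul, hM]
  · intro u _
    simp [Matrix.vecMul_vecMul, hM']

theorem mem_range_encoder_iff (hM : M * M.transpose = 1) (x : Fin (n + n) → ZMod 2) :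
    x ∈ (encoder M).range ↔ ∀ y ∈ (encoder M).range, ∑ i, x i * y i = 0 := by
  have hM' : M.transpose * M = 1 := mul_eq_one_comm.mp hM
  have hdot : ∀ a b c d : Fin n → ZMod 2,
      ∑ i, (Fin.append a b : Fin (n + n) → ZMod 2) i * (Fin.append c d : Fin (n + n) → ZMod 2) i
        = a ⬝ᵥ c + b ⬝ᵥ d := by
    intro a b c d
    simp [Fin.sum_univ_add, dotProduct, -Fin.natAdd_eq_addNat]
  constructor
  · rintro ⟨u, rfl⟩ _ ⟨v, rfl⟩
    rw [encoder_apply, encoder_apply, hdot, ← Matrix.mulVec_transpose M v,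
      Matrix.dotProduct_mulVec, Matrix.vecMul_vecMul, hM, Matrix.vecMul_one,
      CharTwo.add_self_eq_zero]
  · intro h
    obtain ⟨a, b, rfl⟩ : ∃ a b : Fin n → ZMod 2, x = Fin.append a b :=
      ⟨_, _, Fin.append_castAdd_natAdd.symm⟩
    have hab : a = M.mulVec b := by
      refine dotProduct_eq _ _ fun v => ?_
      have := h _ ⟨v, rfl⟩
      rw [encoder_apply, hdot, ← Matrix.mulVec_transpose M v, Matrix.dotProduct_mulVec,
        Matrix.vecMul_transpose] at this
      exact CharTwo.add_eq_zero.mp this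
    refine ⟨a, ?_⟩
    rw [encoder_apply, hab, ← Matrix.mulVec_transpose, Matrix.mulVec_mulVec, hM', Matrix.one_mulVec]

end doubleCode

/-! ### The code -/

/-- The rows of `codeMatrix`, as binary numbers. -/
def codeRows : List ℕ :=
  [12491409983, 16781055360, 4132393925, 3724269544, 7821980985, 6294538807, 1155230281,
   2798580696, 13842437023, 12798310596, 4360293907, 8585272681, 15149798846, 3018306788,
   225248889, 5161410009, 14627117797, 7825440479, 5266093330, 7189380166, 13219529050,
   13124336152, 8974493187, 15052505726, 5839839418, 7254642577, 1459181942, 6498598168,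
   9183994732, 16882689133, 2632965565, 9476501947, 10997416153, 12326294243]

/-- The right half of the generator matrix of a self-dual `[68, 34, 12]` code. -/
def codeMatrix : Matrix (Fin 34) (Fin 34) (ZMod 2) := fun i j =>
  if (codeRows.getD i 0).testBit j then 1 else 0

set_option maxRecDepth 100000 in
theorem codeMatrix_mul_transpose : codeMatrix * codeMatrix.transpose = 1 := by
  decide +kernel

/-- The values `splitCount codeMatrix k l` for `k ≤ 7` and `k + l ≤ 14`. -/
def leftTable : List (List ℕ) :=
  [[1, 0, 0, 0, 0, 0, 0, 0, 0, 0, 0, 0, 0, 0, 0],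
   [0, 0, 0, 0, 0, 0, 0, 0, 0, 0, 0, 0, 0, 0],
   [0, 0, 0, 0, 0, 0, 0, 0, 0, 0, 12, 0, 7],
   [0, 0, 0, 0, 0, 0, 0, 0, 0, 39, 0, 75],
   [0, 0, 0, 0, 0, 0, 0, 0, 107, 0, 311],
   [0, 0, 0, 0, 0, 0, 0, 218, 0, 897],
   [0, 0, 0, 0, 0, 0, 207, 0, 1807],
   [0, 0, 0, 0, 0, 188, 0, 2409]]

/-- The values `splitCount codeMatrix.transpose k l` for `k ≤ 6` and `k + l ≤ 14`. -/
def rightTable : List (List ℕ) :=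
  [[1, 0, 0, 0, 0, 0, 0, 0, 0, 0, 0, 0, 0, 0, 0],
   [0, 0, 0, 0, 0, 0, 0, 0, 0, 0, 0, 0, 0, 0],
   [0, 0, 0, 0, 0, 0, 0, 0, 0, 0, 8, 0, 36],
   [0, 0, 0, 0, 0, 0, 0, 0, 0, 21, 0, 192],
   [0, 0, 0, 0, 0, 0, 0, 0, 82, 0, 628],
   [0, 0, 0, 0, 0, 0, 0, 188, 0, 1407],
   [0, 0, 0, 0, 0, 0, 207, 0, 2215]]

set_option maxRecDepth 100000 in
theorem leftTable_eq :
    ((List.range 8).map fun k => (List.range (15 - k)).map (countRowSums codeMatrix k))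
      = leftTable := by
  decide +kernel

set_option maxRecDepth 100000 in
theorem rightTable_eq :
    ((List.range 7).map fun k => (List.range (15 - k)).map (countRowSums codeMatrix.transpose k))
      = rightTable := by
  decide +kernel

theorem splitCount_eq_of_table {M : Matrix (Fin 34) (Fin 34) (ZMod 2)} {T : List (List ℕ)} {N : ℕ}
    (hT : ((List.range N).map fun k => (List.range (15 - k)).map (countRowSums M k)) = T)
    (hN : N ≤ 8) {k l : ℕ} (hk : k < N) (hl : k + l ≤ 14) :
    splitCount M k l = (T.getD k []).getD l 0 := by
  have hn : ∀ k < 8, numSub (List.replicate 34 true) k ≤ 2 ^ 23 := by decide +kernel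
  rw [splitCount, ← countRowSums_eq M (hn k (hk.trans_le hN)) (by norm_num) (by omega), ← hT]
  have hl' : l < 15 - k := by omega
  simp [List.getD_eq_getElem?_getD, hk, hl']

/-- The values `splitCount codeMatrix k l` for `k + l ≤ 14`. -/
def splitTable (k l : ℕ) : ℕ :=
  if k ≤ 7 then (leftTable.getD k []).getD l 0 else (rightTable.getD l []).getD k 0

theorem splitCount_codeMatrix {k l : ℕ} (h : k + l ≤ 14) :
    splitCount codeMatrix k l = splitTable k l := by
  rw [splitTable]
  split_ifs with hk
  · exact splitCount_eq_of_table leftTable_eq le_rfl (by omega) h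
  · rw [splitCount_transpose codeMatrix_mul_transpose]
    exact splitCount_eq_of_table rightTable_eq (by norm_num) (by omega) (by omega)

theorem ncard_wt_code {w : ℕ} (hw : w ≤ 14) :
    {x | x ∈ (encoder codeMatrix).range ∧ wt x = w}.ncard
      = ∑ k ∈ Finset.range (w + 1), splitTable k (w - k) := by
  rw [ncard_wt_range_encoder]
  refine Finset.sum_congr rfl fun k hk => splitCount_codeMatrix ?_
  rw [Finset.mem_range] at hk
  omega

theorem twelve_le_wt_of_mem_code (x : Fin (34 + 34) → ZMod 2)
    (hx : x ∈ (encoder codeMatrix).range) (hx0 : x ≠ 0) : 12 ≤ wt x := by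
  obtain ⟨u, rfl⟩ := hx
  by_contra! hlt
  rw [wt_encoder] at hlt
  have hpos : splitCount codeMatrix (wt u) (wt (codeMatrix.vecMul u)) ≠ 0 :=
    Finset.card_ne_zero_of_mem (a := u) (by simp)
  rw [splitCount_codeMatrix (by omega)] at hpos
  have hzero : ∀ k < 12, ∀ l < 12, k ≠ 0 → k + l < 12 → splitTable k l = 0 := by decide +kernel
  refine hpos (hzero _ (by omega) _ (by omega) (fun h => hx0 ?_) hlt)
  rw [wt_eq_zero.mp h, map_zero]

/-- There exists a binary self-dual `[68, 34, 12]` code with `A₁₂ = 442 + 4·110 = 882`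
and `A₁₄ = 10864 - 8·110 = 9984` (weight enumerator `W₆₈,₁` with `α = 110`). -/
theorem exists_self_dual_68_34_12_W1 :
    ∃ C : Submodule (ZMod 2) (Fin 68 → ZMod 2),
      (∀ x, x ∈ C ↔ ∀ y ∈ C, ∑ i, x i * y i = 0) ∧
      Module.finrank (ZMod 2) C = 34 ∧
      (∀ x ∈ C, x ≠ 0 → 12 ≤ wt x) ∧
      (∃ x ∈ C, x ≠ 0 ∧ wt x = 12) ∧
      {x | x ∈ C ∧ wt x = 12}.ncard = 442 + 4 * 110 ∧
      {x | x ∈ C ∧ wt x = 14}.ncard = 10864 - 8 * 110 := by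
  have h12 : {x | x ∈ (encoder codeMatrix).range ∧ wt x = 12}.ncard = 442 + 4 * 110 := by
    rw [ncard_wt_code (by norm_num)]
    decide +kernel
  have h14 : {x | x ∈ (encoder codeMatrix).range ∧ wt x = 14}.ncard = 10864 - 8 * 110 := by
    rw [ncard_wt_code (by norm_num)]
    decide +kernel
  refine ⟨(encoder codeMatrix).range, mem_range_encoder_iff codeMatrix_mul_transpose,
    finrank_range_encoder codeMatrix, twelve_le_wt_of_mem_code, ?_, h12, h14⟩
  obtain ⟨x, hx, hw⟩ := Set.nonempty_of_ncard_ne_zero (h12.trans_ne (by norm_num))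
  refine ⟨x, hx, ?_, hw⟩
  rintro rfl
  simp [wt] at hw
end
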